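/- arXiv:2308.07055 — 2 statements merged into one kernel-verified Lean document; each statement's English description precedes it below -/
import Mathlib

section
/- Let a > 0 and let v : ℝ → ℝ be twice differentiable with a² v''(ξ) = −(ξ/2) v'(ξ) for all ξ ∈ ℝ. Then there exist constants C₁, C₂ ∈ ℝ such that v(ξ) = C₁ F(ξ/a) + C₂ for all ξ ∈ ℝ. -/
open Real Filter

/-- The rescaled Gaussian cumulative distribution function
`F(ξ) = (1/(2√π)) ∫_{-∞}^{ξ} e^{-s²/4} ds`. -/
noncomputable def F (x : ℝ) : ℝ :=
  (1 / (2 * Real.sqrt Real.pi)) * ∫ s in Set.Iio x, Real.exp (-s ^ 2 / 4)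

theorem hasDerivAt_F (x : ℝ) :
    HasDerivAt F (1 / (2 * √π) * exp (-x ^ 2 / 4)) x := by
  have hint : MeasureTheory.Integrable (fun s : ℝ => exp (-s ^ 2 / 4)) := by
    convert integrable_exp_neg_mul_sq (b := 1 / 4) (by norm_num) using 3
    ring
  have hcont : Continuous (fun s : ℝ => exp (-s ^ 2 / 4)) := by fun_prop
  have hF : F = fun y => 1 / (2 * √π) *
      ((∫ s in (0 : ℝ)..y, exp (-s ^ 2 / 4)) + ∫ s in Set.Iic (0 : ℝ), exp (-s ^ 2 / 4)) := by
    ext y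
    rw [F, ← MeasureTheory.integral_Iic_eq_integral_Iio,
      ← intervalIntegral.integral_Iic_sub_Iic hint.integrableOn hint.integrableOn,
      sub_add_cancel]
  rw [hF]
  exact ((hcont.integral_hasStrictDerivAt 0 x).hasDerivAt.add_const _).const_mul _

/-- If `a > 0` and `v` is twice differentiable with `a² v'' (ξ) = −(ξ/2) v'(ξ)` for all `ξ`,
then `v(ξ) = C₁ F(ξ/a) + C₂` for some constants `C₁, C₂`. -/
theorem stmt1 (a : ℝ) (ha : 0 < a) (v : ℝ → ℝ)
    (hv1 : Differentiable ℝ v) (hv2 : Differentiable ℝ (deriv v))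
    (hode : ∀ ξ : ℝ, a ^ 2 * deriv (deriv v) ξ = -(ξ / 2) * deriv v ξ) :
    ∃ C₁ C₂ : ℝ, ∀ ξ : ℝ, v ξ = C₁ * F (ξ / a) + C₂ := by
  have hw : ∀ x, HasDerivAt (fun ξ => deriv v ξ * exp ((ξ / a) ^ 2 / 4)) 0 x := by
    intro x
    have hexp := ((((hasDerivAt_id x).div_const a).pow 2).div_const 4).exp
    refine ((hv2 x).hasDerivAt.mul hexp).congr_deriv ?_
    have hx : deriv (deriv v) x = -(x / 2) * deriv v x / a ^ 2 := by
      rw [← hode x]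
      field_simp
    simp only [id, hx, Pi.pow_apply, Nat.add_one_sub_one, pow_one, Nat.cast_ofNat]
    field_simp
    ring
  have hv' : ∀ x, deriv v x = deriv v 0 * exp (-(x / a) ^ 2 / 4) := by
    intro x
    have h := is_const_of_deriv_eq_zero (fun y => (hw y).differentiableAt)
      (fun y => (hw y).deriv) x 0
    simp only [zero_div, ne_eq, OfNat.ofNat_ne_zero, not_false_eq_true, zero_pow, exp_zero,
      mul_one] at h
    rw [← h, mul_assoc, ← exp_add, neg_div, add_neg_cancel, exp_zero, mul_one]
  have hπ : √π ≠ 0 := (sqrt_pos.2 pi_pos).ne'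
  have hd : ∀ x, HasDerivAt
      (fun ξ => v ξ - 2 * √π * a * deriv v 0 * F (ξ / a)) 0 x := by
    intro x
    have hF := (hasDerivAt_F (x / a)).comp x ((hasDerivAt_id x).div_const a)
    refine ((hv1 x).hasDerivAt.sub (hF.const_mul (2 * √π * a * deriv v 0))).congr_deriv ?_
    rw [hv' x]
    field_simp
    ring
  refine ⟨2 * √π * a * deriv v 0, v 0 - 2 * √π * a * deriv v 0 * F (0 / a), fun ξ => ?_⟩
  have h := is_const_of_deriv_eq_zero (fun y => (hd y).differentiableAt)
    (fun y => (hd y).deriv) ξ 0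
  linarith
end

section
/- A point ξ̄ = (ξ₁,…,ξ_n) ∈ Ω satisfies ∇E(ξ̄) = 0 if and only if it satisfies the Stefan system: for each i = 1,…,n, d_i ξ_i/2 + k_i(u_{i+1}−u_i) F'(ξ_i/a_i)/(a_i (F(ξ_{i+1}/a_i) − F(ξ_i/a_i))) − k_{i−1}(u_i−u_{i−1}) F'(ξ_i/a_{i−1})/(a_{i−1} (F(ξ_i/a_{i−1}) − F(ξ_{i−1}/a_{i−1}))) = 0, where ξ₀ = −∞ and ξ_{n+1} = +∞. -/
open Real Filter Finset

/-- The derivative `F'(ξ) = (1/(2√π)) e^{-ξ²/4}`. -/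
noncomputable def F' (x : ℝ) : ℝ :=
  (1 / (2 * Real.sqrt Real.pi)) * Real.exp (-x ^ 2 / 4)

/-- The functional
`E(ξ̄) = −Σ_{i=0}^{n} k_i(u_{i+1}−u_i) ln(F(ξ_{i+1}/a_i) − F(ξ_i/a_i)) + Σ_{i=1}^{n} d_i ξ_i²/4`,
with the conventions `ξ₀ = −∞`, `ξ_{n+1} = +∞`, i.e. `F(ξ₀/a₀) = 0`, `F(ξ_{n+1}/a_n) = 1`.
Here `ξ : ℕ → ℝ`, only the values `ξ 1, …, ξ n` being relevant. -/
noncomputable def E (n : ℕ) (u a k d : ℕ → ℝ) (ξ : ℕ → ℝ) : ℝ :=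
  -(∑ i ∈ Finset.range (n + 1), k i * (u (i + 1) - u i) *
      Real.log ((if i = n then 1 else F (ξ (i + 1) / a i)) -
        (if i = 0 then 0 else F (ξ i / a i))))
  + ∑ i ∈ Finset.Icc 1 n, d i * ξ i ^ 2 / 4

/-- Reindexing of a point of `ℝⁿ` as the sequence `ξ_1, …, ξ_n` (paper indexing). -/
noncomputable def toSeq (n : ℕ) (x : EuclideanSpace ℝ (Fin n)) : ℕ → ℝ :=
  fun i => if h : i - 1 < n then x ⟨i - 1, h⟩ else 0

/-- The left-hand side of the `i`-th equation (`1 ≤ i ≤ n`) of the Stefan system: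
`d_i ξ_i/2 + k_i(u_{i+1}−u_i) F'(ξ_i/a_i)/(a_i (F(ξ_{i+1}/a_i) − F(ξ_i/a_i)))
 − k_{i−1}(u_i−u_{i−1}) F'(ξ_i/a_{i−1})/(a_{i−1} (F(ξ_i/a_{i−1}) − F(ξ_{i−1}/a_{i−1})))`,
with the conventions `ξ₀ = −∞` (so `F(ξ₀/a₀) = 0`) and `ξ_{n+1} = +∞` (so `F(ξ_{n+1}/a_n) = 1`). -/
noncomputable def stefanLHS (n : ℕ) (u a k d : ℕ → ℝ) (ξ : ℕ → ℝ) (i : ℕ) : ℝ :=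
  d i * ξ i / 2
  + k i * (u (i + 1) - u i) * F' (ξ i / a i) /
      (a i * ((if i = n then 1 else F (ξ (i + 1) / a i)) - F (ξ i / a i)))
  - k (i - 1) * (u i - u (i - 1)) * F' (ξ i / a (i - 1)) /
      (a (i - 1) * (F (ξ i / a (i - 1)) - (if i = 1 then 0 else F (ξ (i - 1) / a (i - 1)))))

lemma integrable_exp_neg_sq_div_four : MeasureTheory.Integrable fun s : ℝ => Real.exp (-s ^ 2 / 4) := by
  refine (integrable_exp_neg_mul_sq (b := 1 / 4) (by norm_num)).congr (.of_forall fun s => ?_)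
  simp only
  ring_nf

lemma integral_exp_neg_sq_div_four : ∫ s : ℝ, Real.exp (-s ^ 2 / 4) = 2 * √Real.pi := by
  have h := integral_gaussian (1 / 4)
  have h4 : √(Real.pi / (1 / 4)) = 2 * √Real.pi := by
    rw [show Real.pi / (1 / 4) = 2 ^ 2 * Real.pi by ring, Real.sqrt_mul (by norm_num),
      Real.sqrt_sq (by norm_num)]
  rw [← h4, ← h]
  congr 1
  ext s
  ring_nf

lemma hasDerivAt_F_s2 (x : ℝ) : HasDerivAt F (F' x) x := by
  have hint := integrable_exp_neg_sq_div_four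
  have hc : Continuous fun s : ℝ => Real.exp (-s ^ 2 / 4) := by fun_prop
  have hF : F = fun y => F 0 + (1 / (2 * √Real.pi)) * ∫ s in (0 : ℝ)..y, Real.exp (-s ^ 2 / 4) := by
    ext y
    rw [← intervalIntegral.integral_Iic_sub_Iic hint.integrableOn hint.integrableOn]
    simp only [F, MeasureTheory.integral_Iic_eq_integral_Iio]
    ring
  rw [hF]
  exact ((intervalIntegral.integral_hasDerivAt_right (hc.intervalIntegrable _ _)
    (hc.stronglyMeasurableAtFilter _ _) hc.continuousAt).const_mul _).const_add _

lemma strictMono_F : StrictMono F :=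
  strictMono_of_deriv_pos fun x => by
    rw [(hasDerivAt_F_s2 x).deriv, F']
    positivity

lemma F_pos (x : ℝ) : 0 < F x := by
  have h0 : 0 ≤ F (x - 1) :=
    mul_nonneg (by positivity) (MeasureTheory.integral_nonneg fun s => (Real.exp_pos _).le)
  exact h0.trans_lt (strictMono_F (by linarith))

lemma F_lt_one (x : ℝ) : F x < 1 := by
  have h1 : F (x + 1) ≤ 1 := by
    have h := MeasureTheory.setIntegral_le_integral (s := Set.Iio (x + 1))
      integrable_exp_neg_sq_div_four (.of_forall fun s => (Real.exp_pos _).le)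
    rw [integral_exp_neg_sq_div_four] at h
    rw [F, one_div_mul_eq_div, div_le_one (by positivity)]
    exact h
  exact (strictMono_F (by linarith)).trans_le h1

/-- The derivative of `y ↦ toSeq n y i`. -/
noncomputable def toSeqCoord (n i : ℕ) : EuclideanSpace ℝ (Fin n) →L[ℝ] ℝ :=
  if h : i - 1 < n then EuclideanSpace.proj ⟨i - 1, h⟩ else 0

lemma hasFDerivAt_toSeq (n i : ℕ) (x : EuclideanSpace ℝ (Fin n)) :
    HasFDerivAt (fun y => toSeq n y i) (toSeqCoord n i) x := by
  unfold toSeq toSeqCoord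
  split_ifs with h
  · exact (EuclideanSpace.proj ⟨i - 1, h⟩ : EuclideanSpace ℝ (Fin n) →L[ℝ] ℝ).hasFDerivAt
  · exact hasFDerivAt_const _ _

lemma hasFDerivAt_F_toSeq (n i : ℕ) (c : ℝ) (x : EuclideanSpace ℝ (Fin n)) :
    HasFDerivAt (fun y => F (toSeq n y i / c)) ((F' (toSeq n x i / c) / c) • toSeqCoord n i) x := by
  have h := (hasDerivAt_F_s2 (toSeq n x i / c)).comp (toSeq n x i)
    ((hasDerivAt_id (toSeq n x i)).div_const c)
  have h2 := h.comp_hasFDerivAt x (hasFDerivAt_toSeq n i x)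
  rwa [mul_one_div] at h2

/-- The argument of the `i`-th logarithm in `E`. -/
noncomputable def layerMass (n : ℕ) (a ξ : ℕ → ℝ) (i : ℕ) : ℝ :=
  (if i = n then 1 else F (ξ (i + 1) / a i)) - (if i = 0 then 0 else F (ξ i / a i))

lemma toSeq_lt_toSeq_succ {n : ℕ} {x : EuclideanSpace ℝ (Fin n)}
    (hx : ∀ i j : Fin n, i < j → x i < x j) {i : ℕ} (hi : i ≠ 0) (hin : i < n) :
    toSeq n x i < toSeq n x (i + 1) := by
  have h1 : i - 1 < n := by omega
  have h2 : i + 1 - 1 < n := by omega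
  simp only [toSeq, dif_pos h1, dif_pos h2]
  exact hx _ _ (Fin.mk_lt_mk.2 (by omega))

lemma layerMass_pos {n : ℕ} (hn : 1 ≤ n) {a : ℕ → ℝ} (ha : ∀ i ≤ n, 0 < a i)
    {x : EuclideanSpace ℝ (Fin n)} (hx : ∀ i j : Fin n, i < j → x i < x j) {i : ℕ} (hi : i ≤ n) :
    0 < layerMass n a (toSeq n x) i := by
  unfold layerMass
  split_ifs with h1 h0 h0
  · omega
  · exact sub_pos.2 (F_lt_one _)
  · exact sub_pos.2 (F_pos _)
  · exact sub_pos.2 (strictMono_F (div_lt_div_of_pos_right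
      (toSeq_lt_toSeq_succ hx h0 (by omega)) (ha i hi)))

lemma hasFDerivAt_layerMass (n : ℕ) (a : ℕ → ℝ) (x : EuclideanSpace ℝ (Fin n)) (i : ℕ) :
    HasFDerivAt (fun y => layerMass n a (toSeq n y) i)
      ((if i = n then 0 else (F' (toSeq n x (i + 1) / a i) / a i) • toSeqCoord n (i + 1)) -
        (if i = 0 then 0 else (F' (toSeq n x i / a i) / a i) • toSeqCoord n i)) x := by
  unfold layerMass
  refine HasFDerivAt.fun_sub ?_ ?_
  · split_ifs
    · exact hasFDerivAt_const _ _
    · exact hasFDerivAt_F_toSeq _ _ _ _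
  · split_ifs
    · exact hasFDerivAt_const _ _
    · exact hasFDerivAt_F_toSeq _ _ _ _

lemma hasFDerivAt_E {n : ℕ} (hn : 1 ≤ n) (u k d : ℕ → ℝ) {a : ℕ → ℝ} (ha : ∀ i ≤ n, 0 < a i)
    {x : EuclideanSpace ℝ (Fin n)} (hx : ∀ i j : Fin n, i < j → x i < x j) :
    HasFDerivAt (fun y => E n u a k d (toSeq n y))
      (∑ i ∈ Finset.range n, stefanLHS n u a k d (toSeq n x) (i + 1) • toSeqCoord n (i + 1)) x := by
  have hlog : ∀ i ∈ Finset.range (n + 1), HasFDerivAt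
      (fun y => k i * (u (i + 1) - u i) * Real.log (layerMass n a (toSeq n y) i)) _ x :=
    fun i hi => ((hasFDerivAt_layerMass n a x i).log
      (layerMass_pos hn ha hx (Finset.mem_range_succ_iff.1 hi)).ne').const_mul
        (k i * (u (i + 1) - u i))
  have hquad : ∀ i ∈ Finset.Icc 1 n, HasFDerivAt
      (fun y => d i * toSeq n y i ^ 2 / 4) ((d i * toSeq n x i / 2) • toSeqCoord n i) x := by
    intro i _
    have h := (((hasDerivAt_id (toSeq n x i)).pow 2).const_mul (d i)).div_const 4
    refine (h.comp_hasFDerivAt x (hasFDerivAt_toSeq n i x)).congr_fderiv ?_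
    congr 1
    simp
    ring
  refine ((HasFDerivAt.fun_sum hlog).fun_neg.fun_add (HasFDerivAt.fun_sum hquad)).congr_fderiv ?_
  have hIcc : ∀ f : ℕ → EuclideanSpace ℝ (Fin n) →L[ℝ] ℝ,
      ∑ i ∈ Finset.Icc 1 n, f i = ∑ i ∈ Finset.range n, f (i + 1) := fun f => by
    rw [← Finset.Ico_add_one_right_eq_Icc, Finset.sum_Ico_eq_sum_range]
    simp [add_comm]
  simp only [smul_sub, Finset.sum_sub_distrib]
  rw [hIcc, Finset.sum_range_succ, Finset.sum_range_succ' (n := n), if_pos rfl, if_pos rfl]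
  simp only [smul_zero, add_zero, neg_sub]
  rw [← Finset.sum_sub_distrib, ← Finset.sum_add_distrib]
  refine Finset.sum_congr rfl fun i hi => ?_
  have hin : i < n := Finset.mem_range.1 hi
  rw [if_neg hin.ne, if_neg i.succ_ne_zero]
  simp only [smul_smul, ← sub_smul, ← add_smul]
  congr 1
  simp only [stefanLHS, layerMass, add_tsub_cancel_right, if_neg i.succ_ne_zero, if_neg hin.ne,
    Nat.add_eq_right, div_eq_mul_inv, mul_inv]
  ring

/-- A point `ξ̄ ∈ Ω` satisfies `∇E(ξ̄) = 0` if and only if it solves the Stefan system. -/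
theorem stmt2 (n : ℕ) (hn : 1 ≤ n) (u a k d : ℕ → ℝ)
    (hu : ∀ i ≤ n, u i < u (i + 1))
    (ha : ∀ i ≤ n, 0 < a i)
    (hk : ∀ i ≤ n, 0 < k i)
    (x : EuclideanSpace ℝ (Fin n))
    (hx : ∀ i j : Fin n, i < j → x i < x j) :
    gradient (fun y => E n u a k d (toSeq n y)) x = 0 ↔
      ∀ i, 1 ≤ i → i ≤ n → stefanLHS n u a k d (toSeq n x) i = 0 := by
  have hE := hasFDerivAt_E hn u k d ha hx
  rw [gradient, hE.fderiv, LinearIsometryEquiv.map_eq_zero_iff]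
  constructor
  · intro h i hi hin
    have hi' : i - 1 < n := by omega
    have h' := DFunLike.congr_fun h (EuclideanSpace.single ⟨i - 1, hi'⟩ (1 : ℝ))
    rw [_root_.sum_apply, Finset.sum_eq_single_of_mem (i - 1)
      (Finset.mem_range.2 hi')] at h'
    · simpa [toSeqCoord, hi', Nat.sub_add_cancel hi] using h'
    · intro j hj hne
      simp [toSeqCoord, Finset.mem_range.1 hj, hne]
  · intro h
    refine Finset.sum_eq_zero fun i hi => ?_
    rw [h (i + 1) (by omega) (Finset.mem_range.1 hi), zero_smul]
end
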